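/- Nondeterministic SAFA can be exponentially more succinct than deterministic SAFA: for every n ≥ 1 there exists a regular language R_n ⊆ Σ* (over a fixed two-letter alphabet Σ) such that the data language L_n = { w ∈ (Σ × D)* : proj_Σ(w) ∈ R_n } is accepted by a nondeterministic SAFA with at most n+1 states, while every DSAFA accepting L_n has at least 2^n states. -/

import Mathlib

/-- A condition tested by a SAFA transition: membership (`pos h` = `p(h)`)
or non-membership (`neg h` = `!p(h)`) of the current data value in set `h`. -/
inductive SafaCond (H : Type) : Type
  | pos (h : H)
  | neg (h : H)

/-- The set name a condition refers to. -/
def SafaCond.name {H : Type} : SafaCond H → H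
  | .pos h => h
  | .neg h => h

/-- An operation of a SAFA transition: do nothing (`−`) or insert the
current data value into set `h` (`ins(h)`). -/
inductive SafaOp (H : Type) : Type
  | noop
  | ins (h : H)

/-- Whether a condition holds for data value `d` given set contents `s`. -/
def SafaCond.holds {H D : Type} : SafaCond H → D → (H → Set D) → Prop
  | .pos h, d, s => d ∈ s h
  | .neg h, d, s => d ∉ s h

/-- The effect of an operation on the set contents, reading data value `d`. -/
def SafaOp.apply {H D : Type} : SafaOp H → D → (H → Set D) → (H → Set D)
  | .noop, _, s => s
  | .ins h, d, s => fun j => s j ∪ {x | j = h ∧ x = d}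

/-- A transition of a SAFA: source state, attribute, condition, operation, target state. -/
structure SafaTrans (Q A H : Type) : Type where
  src : Q
  attr : A
  cond : SafaCond H
  op : SafaOp H
  dst : Q

/-- A set augmented finite automaton over attributes `A` and data values `D`:
a finite set of states `Q` with initial state `q0` and final states `F`,
a finite collection `H` of set names, and a transition relation `δ`. -/
structure SAFA (A D : Type) : Type 1 where
  Q : Type
  fintypeQ : Fintype Q
  q0 : Q
  F : Set Q
  H : Type
  fintypeH : Fintype H
  δ : Set (SafaTrans Q A H)

attribute [instance] SAFA.fintypeQ SAFA.fintypeH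

namespace SAFA

variable {A D : Type}

/-- A configuration: a state together with the current contents of the sets. -/
abbrev Config (M : SAFA A D) : Type := M.Q × (M.H → Set D)

/-- The initial configuration: initial state, all sets empty. -/
def init (M : SAFA A D) : M.Config := (M.q0, fun _ => ∅)

/-- One step: from configuration `c`, taking transition `t` while reading letter `ad`,
reaching configuration `c'`. -/
def StepVia (M : SAFA A D) (c : M.Config) (t : SafaTrans M.Q A M.H)
    (ad : A × D) (c' : M.Config) : Prop :=
  t ∈ M.δ ∧ t.src = c.1 ∧ t.attr = ad.1 ∧ t.dst = c'.1 ∧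
    t.cond.holds ad.2 c.2 ∧ c'.2 = t.op.apply ad.2 c.2

/-- Execution of a sequence of transitions `T` reading the data word `w`,
from configuration `c` to configuration `c'`. -/
inductive ExecFrom (M : SAFA A D) :
    M.Config → List (SafaTrans M.Q A M.H) → List (A × D) → M.Config → Prop
  | nil (c : M.Config) : ExecFrom M c [] [] c
  | cons {c c' c'' : M.Config} {t : SafaTrans M.Q A M.H}
      {ts : List (SafaTrans M.Q A M.H)} {ad : A × D} {w : List (A × D)} :
      M.StepVia c t ad c' → ExecFrom M c' ts w c'' → ExecFrom M c (t :: ts) (ad :: w) c''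

/-- Acceptance: some run from the initial configuration consumes all of `w`
and ends in a final state. -/
def Accepts (M : SAFA A D) (w : List (A × D)) : Prop :=
  ∃ T c, M.ExecFrom M.init T w c ∧ c.1 ∈ M.F

/-- The data language accepted by `M`. -/
def Lang (M : SAFA A D) : Set (List (A × D)) := {w | M.Accepts w}

/-- A SAFA is deterministic if, for every state and attribute, all outgoing
transitions test membership in one and the same set, with at most one transition
per polarity of the condition. -/
def IsDeterministic (M : SAFA A D) : Prop :=
  ∀ t1 t2 : SafaTrans M.Q A M.H, t1 ∈ M.δ → t2 ∈ M.δ →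
    t1.src = t2.src → t1.attr = t2.attr →
    t1.cond.name = t2.cond.name ∧ (t1.cond = t2.cond → t1 = t2)

end SAFA

namespace NFA

variable {α σ : Type*} {N : NFA α σ}

theorem nil_mem_acceptsFrom_singleton {q : σ} : [] ∈ N.acceptsFrom {q} ↔ q ∈ N.accept := by
  simp

theorem cons_mem_acceptsFrom_singleton {q : σ} {a : α} {w : List α} :
    a :: w ∈ N.acceptsFrom {q} ↔ ∃ r ∈ N.step q a, w ∈ N.acceptsFrom {r} := by
  rw [cons_mem_acceptsFrom, stepSet_singleton]
  simp only [mem_acceptsFrom]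
  constructor
  · rintro ⟨s, hs, hw⟩
    obtain ⟨r, hr, h⟩ := mem_evalFrom_iff_exists.1 hw
    exact ⟨r, hr, s, hs, h⟩
  · rintro ⟨r, hr, s, hs, h⟩
    exact ⟨s, hs, mem_evalFrom_iff_exists.2 ⟨r, hr, h⟩⟩

theorem evalFrom_subsingleton (hN : ∀ q a, (N.step q a).Subsingleton) {S : Set σ}
    (hS : S.Subsingleton) (w : List α) : (N.evalFrom S w).Subsingleton := by
  induction w generalizing S with
  | nil => exact hS
  | cons a w ih =>
    refine ih fun x hx y hy => ?_
    obtain ⟨s, hs, hx⟩ := mem_stepSet.1 hx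
    obtain ⟨t, ht, hy⟩ := mem_stepSet.1 hy
    obtain rfl := hS hs ht
    exact hN _ _ hx hy

end NFA

namespace SAFA

variable {A D : Type}

/-- Acceptance of a data word from an arbitrary configuration. -/
def AcceptsFrom (M : SAFA A D) (c : M.Config) (w : List (A × D)) : Prop :=
  ∃ T c', M.ExecFrom c T w c' ∧ c'.1 ∈ M.F

theorem acceptsFrom_nil {M : SAFA A D} {c : M.Config} : M.AcceptsFrom c [] ↔ c.1 ∈ M.F := by
  constructor
  · rintro ⟨T, c', h, hF⟩
    cases h
    exact hF
  · exact fun h => ⟨[], c, .nil c, h⟩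

theorem acceptsFrom_cons {M : SAFA A D} {c : M.Config} {x : A × D} {w : List (A × D)} :
    M.AcceptsFrom c (x :: w) ↔ ∃ t c', M.StepVia c t x c' ∧ M.AcceptsFrom c' w := by
  constructor
  · rintro ⟨T, c'', h, hF⟩
    cases h with
    | cons hs hw => exact ⟨_, _, hs, _, _, hw, hF⟩
  · rintro ⟨t, c', hs, T, c'', hw, hF⟩
    exact ⟨t :: T, c'', .cons hs hw, hF⟩

/-- The SAFA that simulates an NFA with a single start state and never inserts a data value. -/
def ofNFA {σ : Type} [Fintype σ] (N : NFA A σ) (q₀ : σ) (D : Type) : SAFA A D where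
  Q := σ
  fintypeQ := inferInstance
  q0 := q₀
  F := N.accept
  H := Unit
  fintypeH := inferInstance
  δ := {t | t.cond = .neg () ∧ t.op = .noop ∧ t.dst ∈ N.step t.src t.attr}

theorem acceptsFrom_ofNFA {σ : Type} [Fintype σ] (N : NFA A σ) (q₀ q : σ)
    (w : List (A × D)) :
    (ofNFA N q₀ D).AcceptsFrom (q, fun _ => ∅) w ↔ w.map Prod.fst ∈ N.acceptsFrom {q} := by
  induction w generalizing q with
  | nil =>
    rw [acceptsFrom_nil, List.map_nil, NFA.nil_mem_acceptsFrom_singleton]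
    rfl
  | cons x w ih =>
    rw [acceptsFrom_cons, List.map_cons, NFA.cons_mem_acceptsFrom_singleton]
    constructor
    · rintro ⟨⟨q', a, cond, op, r⟩, ⟨r', s⟩, ⟨⟨hc, ho, hd⟩, hsrc, hattr, hdst, -, hs⟩, hw⟩
      dsimp only at hc ho hd hsrc hattr hdst hs
      subst hc ho hsrc hattr hdst hs
      exact ⟨r, hd, (ih r).1 hw⟩
    · rintro ⟨r, hr, hw⟩
      exact ⟨⟨q, x.1, .neg (), .noop, r⟩, (r, fun _ => ∅),
        ⟨⟨rfl, rfl, hr⟩, rfl, rfl, rfl, Set.notMem_empty _, rfl⟩, (ih r).2 hw⟩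

theorem mem_lang_ofNFA {σ : Type} [Fintype σ] (N : NFA A σ) (q₀ : σ) (w : List (A × D)) :
    w ∈ (ofNFA N q₀ D).Lang ↔ w.map Prod.fst ∈ N.acceptsFrom {q₀} :=
  acceptsFrom_ofNFA N q₀ q₀ w

/-- The NFA describing the behaviour of a SAFA on words whose data values are pairwise distinct:
only transitions conditioned on non-membership can be taken. -/
def freshNFA (M : SAFA A D) : NFA A M.Q where
  step q a := {r | ∃ t ∈ M.δ, t.src = q ∧ t.attr = a ∧ t.dst = r ∧ ∃ h, t.cond = .neg h}
  start := {M.q0}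
  accept := M.F

theorem freshNFA_step_subsingleton (M : SAFA A D) (hM : M.IsDeterministic) (q : M.Q) (a : A) :
    (M.freshNFA.step q a).Subsingleton := by
  rintro _ ⟨t, ht, hq, ha, rfl, h, hc⟩ _ ⟨t', ht', hq', ha', rfl, h', hc'⟩
  obtain ⟨hname, heq⟩ := hM t t' ht ht' (hq.trans hq'.symm) (ha.trans ha'.symm)
  rw [hc, hc'] at hname
  obtain rfl : h = h' := hname
  rw [heq (hc.trans hc'.symm)]

theorem mem_apply_of_mem_op {H : Type} {op : SafaOp H} {d x : D} {s : H → Set D} {h : H}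
    (hx : x ∈ op.apply d s h) : x ∈ s h ∨ x = d := by
  cases op with
  | noop => exact .inl hx
  | ins j => exact hx.imp_right And.right

theorem acceptsFrom_iff_freshNFA (M : SAFA A D) {c : M.Config} {w : List (A × D)}
    (hnodup : (w.map Prod.snd).Nodup) (hfresh : ∀ d ∈ w.map Prod.snd, ∀ h, d ∉ c.2 h) :
    M.AcceptsFrom c w ↔ w.map Prod.fst ∈ M.freshNFA.acceptsFrom {c.1} := by
  induction w generalizing c with
  | nil =>
    rw [acceptsFrom_nil, List.map_nil, NFA.nil_mem_acceptsFrom_singleton]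
    rfl
  | cons x w ih =>
    rw [List.map_cons, List.nodup_cons] at hnodup
    have hstep : ∀ op : SafaOp M.H, ∀ r : M.Q,
        M.AcceptsFrom (r, op.apply x.2 c.2) w ↔ w.map Prod.fst ∈ M.freshNFA.acceptsFrom {r} := by
      refine fun op r => ih hnodup.2 fun d hd h hmem => ?_
      rcases mem_apply_of_mem_op hmem with hmem | rfl
      · exact hfresh d (List.mem_cons_of_mem _ hd) h hmem
      · exact hnodup.1 hd
    have hx : ∀ h, x.2 ∉ c.2 h := hfresh x.2 List.mem_cons_self
    rw [acceptsFrom_cons, List.map_cons, NFA.cons_mem_acceptsFrom_singleton]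
    constructor
    · rintro ⟨t, ⟨r, s⟩, ⟨ht, hsrc, hattr, hdst, hc, hs⟩, hw⟩
      dsimp only at hdst hs
      subst hs
      refine ⟨r, ⟨t, ht, hsrc, hattr, hdst, ?_⟩, (hstep _ r).1 hw⟩
      cases hcond : t.cond with
      | pos h =>
        rw [hcond] at hc
        exact absurd hc (hx h)
      | neg h => exact ⟨h, rfl⟩
    · rintro ⟨r, ⟨t, ht, hsrc, hattr, hdst, h, hcond⟩, hw⟩
      refine ⟨t, (r, t.op.apply x.2 c.2), ⟨ht, hsrc, hattr, hdst, ?_, rfl⟩, (hstep _ r).2 hw⟩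
      rw [hcond]
      exact hx h

theorem map_fst_fresh (e : ℕ → D) (u : List A) :
    (u.zipIdx.map (Prod.map id e)).map Prod.fst = u := by
  rw [List.map_map]
  exact List.zipIdx_map_fst 0 u

theorem fresh_mem_lang_iff (M : SAFA A D) (e : ℕ ↪ D) (u : List A) :
    u.zipIdx.map (Prod.map id e) ∈ M.Lang ↔ u ∈ M.freshNFA.accepts := by
  have hsnd : (u.zipIdx.map (Prod.map id e)).map Prod.snd = (List.range' 0 u.length).map e := by
    rw [← List.zipIdx_map_snd 0 u, List.map_map, List.map_map]
    rfl
  have h := M.acceptsFrom_iff_freshNFA (c := M.init) (w := u.zipIdx.map (Prod.map id e))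
    (by rw [hsnd]; exact (List.nodup_range' ..).map e.injective)
    (fun _ _ _ => Set.notMem_empty _)
  rwa [map_fst_fresh] at h

end SAFA

/-- The words over `{0, 1}` whose `n`-th letter from the end is `1`. -/
def oneAtFromEnd (n : ℕ) : Language (Fin 2) :=
  {w | n ≤ w.length ∧ w[w.length - n]? = some 1}

theorem mem_oneAtFromEnd {n : ℕ} {w : List (Fin 2)} :
    w ∈ oneAtFromEnd n ↔ n ≤ w.length ∧ w[w.length - n]? = some 1 :=
  Iff.rfl

theorem cons_mem_oneAtFromEnd {n : ℕ} (hn : 1 ≤ n) {a : Fin 2} {w : List (Fin 2)} :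
    a :: w ∈ oneAtFromEnd n ↔ w ∈ oneAtFromEnd n ∨ a = 1 ∧ w.length + 1 = n := by
  simp only [mem_oneAtFromEnd, List.length_cons]
  rcases lt_trichotomy n (w.length + 1) with h | h | h
  · rw [Nat.succ_sub (by omega), List.getElem?_cons_succ]
    constructor
    · exact fun h' => .inl ⟨by omega, h'.2⟩
    · rintro (h' | h')
      · exact ⟨by omega, h'.2⟩
      · omega
  · subst h
    simp
  · constructor <;> intro h' <;> omega

theorem append_mem_oneAtFromEnd {n i : ℕ} {u v : List (Fin 2)} (hu : u.length = n)
    (hv : v.length = i) (hi : i < n) : u ++ v ∈ oneAtFromEnd n ↔ u[i]? = some 1 := by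
  rw [mem_oneAtFromEnd, List.length_append, hu, hv, Nat.add_sub_cancel_left,
    List.getElem?_append_left (by omega)]
  simp

/-- The NFA guessing the `n`-th letter from the end: it stays in state `0` until the guess,
then counts the remaining letters. -/
def guessNFA (n : ℕ) : NFA (Fin 2) (Fin (n + 1)) where
  step q a := {r | q.1 = 0 ∧ r.1 = 0 ∨ q.1 = 0 ∧ a = 1 ∧ r.1 = 1 ∨ 0 < q.1 ∧ r.1 = q.1 + 1}
  start := {0}
  accept := {Fin.last n}

theorem guessNFA_acceptsFrom_pos {n : ℕ} {q : Fin (n + 1)} (hq : 0 < q.1) {w : List (Fin 2)} :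
    w ∈ (guessNFA n).acceptsFrom {q} ↔ q.1 + w.length = n := by
  induction w generalizing q with
  | nil =>
    rw [NFA.nil_mem_acceptsFrom_singleton]
    exact Fin.ext_iff
  | cons a w ih =>
    rw [NFA.cons_mem_acceptsFrom_singleton, List.length_cons]
    constructor
    · rintro ⟨r, hr, hw⟩
      obtain hr | hr | hr := hr
      · omega
      · omega
      · have := (ih (by omega)).1 hw
        omega
    · intro h
      exact ⟨⟨q.1 + 1, by omega⟩, .inr (.inr ⟨hq, rfl⟩), (ih (Nat.succ_pos _)).2 (by simp; omega)⟩

theorem guessNFA_accepts {n : ℕ} (hn : 1 ≤ n) : (guessNFA n).accepts = oneAtFromEnd n := by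
  ext w
  change w ∈ (guessNFA n).acceptsFrom {0} ↔ _
  induction w with
  | nil =>
    rw [NFA.nil_mem_acceptsFrom_singleton, mem_oneAtFromEnd]
    refine ⟨fun h => ?_, fun h => ?_⟩
    · have : 0 = n := Fin.ext_iff.1 h
      omega
    · have : n ≤ 0 := h.1
      omega
  | cons a w ih =>
    rw [NFA.cons_mem_acceptsFrom_singleton, cons_mem_oneAtFromEnd hn, ← ih]
    constructor
    · rintro ⟨r, hr, hw⟩
      obtain ⟨-, hr⟩ | ⟨-, ha, hr⟩ | ⟨h0, -⟩ := hr
      · obtain rfl : r = 0 := Fin.ext hr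
        exact .inl hw
      · have := (guessNFA_acceptsFrom_pos (by omega)).1 hw
        exact .inr ⟨ha, by omega⟩
      · exact absurd h0 (lt_irrefl 0)
    · rintro (hw | ⟨ha, hl⟩)
      · exact ⟨0, .inl ⟨rfl, rfl⟩, hw⟩
      · exact ⟨⟨1, by omega⟩, .inr (.inl ⟨rfl, ha, rfl⟩),
          (guessNFA_acceptsFrom_pos Nat.one_pos).2 (by simp; omega)⟩

theorem two_pow_le_card_of_accepts_eq {σ : Type*} [Fintype σ] {N : NFA (Fin 2) σ} {n : ℕ}
    (hstart : N.start.Subsingleton) (hstep : ∀ q a, (N.step q a).Subsingleton) (hn : 1 ≤ n)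
    (hN : N.accepts = oneAtFromEnd n) : 2 ^ n ≤ Fintype.card σ := by
  have hmem : ∀ u v, u ++ v ∈ oneAtFromEnd n ↔ v ∈ N.acceptsFrom (N.evalFrom N.start u) := by
    intro u v
    rw [← hN, NFA.accepts_eq_acceptsFrom_start, NFA.append_mem_acceptsFrom]
  have hne : ∀ f : Fin n → Fin 2, (N.evalFrom N.start (List.ofFn f)).Nonempty := by
    intro f
    have h : List.ofFn f ++ 1 :: List.replicate (n - 1) 0 ∈ oneAtFromEnd n := by
      have hlen : (List.ofFn f ++ 1 :: List.replicate (n - 1) 0).length = n + n := by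
        simp; omega
      rw [mem_oneAtFromEnd, hlen, Nat.add_sub_cancel, List.getElem?_append_right (by simp)]
      simp
    rw [hmem] at h
    obtain ⟨s, -, hs⟩ := h
    obtain ⟨t, ht, -⟩ := NFA.mem_evalFrom_iff_exists.1 hs
    exact ⟨t, ht⟩
  choose g hg using hne
  have heval : ∀ f, N.evalFrom N.start (List.ofFn f) = {g f} := fun f =>
    (NFA.evalFrom_subsingleton hstep hstart _).eq_singleton_of_mem (hg f)
  have hinj : Function.Injective g := by
    intro f f' hff
    funext i
    have key : ∀ k : Fin n → Fin 2, k i = 1 ↔ List.replicate i.1 0 ∈ N.acceptsFrom {g k} := by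
      intro k
      rw [← heval, ← hmem,
        append_mem_oneAtFromEnd (List.length_ofFn) (List.length_replicate) i.2]
      simp
    have h : f i = 1 ↔ f' i = 1 := by rw [key, key, hff]
    omega
  simpa using Fintype.card_le_of_injective g hinj

/-- nondeterministic SAFA can be exponentially more succinct than
deterministic SAFA: for every n ≥ 1 there is a regular language R over a two-letter
alphabet such that L = { w : proj_Σ(w) ∈ R } is accepted by a SAFA with at most n+1
states, while every DSAFA accepting L has at least 2^n states. -/
theorem safa_nondet_succinctness {D : Type} [Countable D] [Infinite D]
    (n : ℕ) (hn : 1 ≤ n) :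
    ∃ R : Language (Fin 2),
      (∃ (σ : Type) (_ : Fintype σ) (dfa : DFA (Fin 2) σ), dfa.accepts = R) ∧
      (∃ M : SAFA (Fin 2) D,
        M.Lang = {w : List (Fin 2 × D) | w.map Prod.fst ∈ R} ∧
        Fintype.card M.Q ≤ n + 1) ∧
      ∀ M : SAFA (Fin 2) D, M.IsDeterministic →
        M.Lang = {w : List (Fin 2 × D) | w.map Prod.fst ∈ R} →
        2 ^ n ≤ Fintype.card M.Q := by
  refine ⟨oneAtFromEnd n, ?_, ⟨SAFA.ofNFA (guessNFA n) 0 D, ?_, (Fintype.card_fin _).le⟩, ?_⟩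
  · exact ⟨Set (Fin (n + 1)), inferInstance, (guessNFA n).toDFA,
      NFA.toDFA_correct.trans (guessNFA_accepts hn)⟩
  · ext w
    rw [SAFA.mem_lang_ofNFA, ← guessNFA_accepts hn]
    rfl
  · intro M hM hL
    refine two_pow_le_card_of_accepts_eq (N := M.freshNFA) Set.subsingleton_singleton
      (fun q a => M.freshNFA_step_subsingleton hM q a) hn ?_
    ext u
    rw [← SAFA.fresh_mem_lang_iff M (Infinite.natEmbedding D), hL, Set.mem_ofPred_eq,
      SAFA.map_fst_fresh]
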